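/- Let n_t, T be positive integers and let A, B ∈ ℂ^{n_t×T} be two weight matrices that are Hurwitz–Radon mutually orthogonal, i.e. A·Bᴴ + B·Aᴴ = 0 (the n_t×n_t zero matrix), where ᴴ denotes conjugate transpose. Then for every number of receive antennas n_r and every channel matrix H ∈ ℂ^{n_r×n_t}, the realified vectorizations of HA and HB are orthogonal: ⟨ṽec(HA), ṽec(HB)⟩ = 0. -/

import Mathlib

open Matrix Complex
open scoped RealInnerProductSpace ComplexConjugate

/-- Realified (column-stacked) vectorization of a complex matrix. -/
noncomputable def tvec {m n : ℕ} (X : Matrix (Fin m) (Fin n) ℂ) :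
    EuclideanSpace ℝ (Fin n × Fin m × Fin 2) :=
  WithLp.toLp 2 fun p => if p.2.2 = 0 then (X p.2.1 p.1).re else (X p.2.1 p.1).im

theorem real_inner_tvec {m n : ℕ} (X Y : Matrix (Fin m) (Fin n) ℂ) :
    ⟪tvec X, tvec Y⟫ = (X * Yᴴ).trace.re := by
  simp only [tvec, PiLp.inner_apply, Fintype.sum_prod_type, Fin.sum_univ_two, Matrix.trace,
    Matrix.diag_apply, Matrix.mul_apply, Matrix.conjTranspose_apply, Complex.re_sum]
  rw [Finset.sum_comm]
  refine Finset.sum_congr rfl fun i _ => Finset.sum_congr rfl fun j _ => ?_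
  simp
  ring

/-- if two weight matrices are Hurwitz–Radon mutually orthogonal,
`A·Bᴴ + B·Aᴴ = 0`, then for every `n_r` and every channel matrix `H`, the realified
vectorizations of `H*A` and `H*B` are orthogonal. -/
theorem stmt1 (nt T : ℕ) (hnt : 0 < nt) (hT : 0 < T)
    (A B : Matrix (Fin nt) (Fin T) ℂ)
    (hHR : A * Bᴴ + B * Aᴴ = 0) :
    ∀ (nr : ℕ) (H : Matrix (Fin nr) (Fin nt) ℂ),
      ⟪tvec (H * A), tvec (H * B)⟫ = 0 := by
  intro nr H
  have key : (H * A) * (H * B)ᴴ + (H * B) * (H * A)ᴴ = 0 := by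
    calc (H * A) * (H * B)ᴴ + (H * B) * (H * A)ᴴ
        = H * (A * Bᴴ + B * Aᴴ) * Hᴴ := by
          simp only [Matrix.conjTranspose_mul, Matrix.mul_add, Matrix.add_mul, Matrix.mul_assoc]
      _ = 0 := by rw [hHR, Matrix.mul_zero, Matrix.zero_mul]
  have hsum : ⟪tvec (H * A), tvec (H * B)⟫ + ⟪tvec (H * B), tvec (H * A)⟫ = 0 := by
    rw [real_inner_tvec, real_inner_tvec, ← Complex.add_re, ← Matrix.trace_add, key,
      Matrix.trace_zero, Complex.zero_re]
  rw [real_inner_comm (tvec (H * A)) (tvec (H * B))] at hsum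
  linarith
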